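/- arXiv:cs/0607132 — 2 statements merged into one kernel-verified Lean document; each statement's English description precedes it below -/
import Mathlib

section
/- Let q ≥ 2 be an integer and ℓ ∈ {0,1,…,q−1}, and set b = ⌈q/(ℓ+1)⌉. There exists a constant K > 0 such that for every integer n ≥ 1, A_u(n,ℓ)_q ≥ K · b^n · n^{−(1/2)·log_q b}. -/
open Finset Filter

/-- `x` is a word over the alphabet `Q = {0,1,…,q-1}`. -/
def inQ (q : ℤ) {n : ℕ} (x : Fin n → ℤ) : Prop :=
  ∀ i, 0 ≤ x i ∧ x i ≤ q - 1

/-- `d(x,y) = max_i |x_i - y_i|`. -/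
def dmax {n : ℕ} (x y : Fin n → ℤ) : ℤ :=
  ((Finset.univ.sup fun i => (x i - y i).natAbs : ℕ) : ℤ)

/-- `d_u(x,y)`: equals `d(x,y)` if `x ≥ y` or `y ≥ x`, and `2·d(x,y)` otherwise. -/
def du {n : ℕ} (x y : Fin n → ℤ) : ℤ :=
  if (∀ i, y i ≤ x i) ∨ (∀ i, x i ≤ y i) then dmax x y else 2 * dmax x y

/-- Maximum size of an `ℓ`-AEC code in `Q^n`. -/
noncomputable def Aa (q : ℤ) (n : ℕ) (ℓ : ℤ) : ℕ :=
  sSup {k : ℕ | ∃ C : Finset (Fin n → ℤ), (∀ x ∈ C, inQ q x) ∧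
    (∀ x ∈ C, ∀ y ∈ C, x ≠ y → ℓ + 1 ≤ dmax x y) ∧ C.card = k}

/-- Maximum size of an `ℓ`-UEC code in `Q^n`. -/
noncomputable def Au (q : ℤ) (n : ℕ) (ℓ : ℤ) : ℕ :=
  sSup {k : ℕ | ∃ C : Finset (Fin n → ℤ), (∀ x ∈ C, inQ q x) ∧
    (∀ x ∈ C, ∀ y ∈ C, x ≠ y → 2 * ℓ + 1 ≤ du x y) ∧ C.card = k}

/-- `C` is a code of Varshamov–Tenengolts type: the solution set in `Q^n`
of a linear equation `Σ aᵢ xᵢ = a` over `ℤ`. -/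
def IsVT (q : ℤ) {n : ℕ} (C : Finset (Fin n → ℤ)) : Prop :=
  ∃ (coef : Fin n → ℤ) (a : ℤ),
    ∀ x : Fin n → ℤ, x ∈ C ↔ (inQ q x ∧ ∑ i, coef i * x i = a)

/-- Maximum size of a VT-type `ℓ`-AEC code in `Q^n`. -/
noncomputable def LAa (q : ℤ) (n : ℕ) (ℓ : ℤ) : ℕ :=
  sSup {k : ℕ | ∃ C : Finset (Fin n → ℤ), IsVT q C ∧
    (∀ x ∈ C, ∀ y ∈ C, x ≠ y → ℓ + 1 ≤ dmax x y) ∧ C.card = k}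

/-- Maximum size of a VT-type `ℓ`-UEC code in `Q^n`. -/
noncomputable def LAu (q : ℤ) (n : ℕ) (ℓ : ℤ) : ℕ :=
  sSup {k : ℕ | ∃ C : Finset (Fin n → ℤ), IsVT q C ∧
    (∀ x ∈ C, ∀ y ∈ C, x ≠ y → 2 * ℓ + 1 ≤ du x y) ∧ C.card = k}

/-- `γ_n(r) = |C_n(r)|` where
`C_n(r) = {x ∈ Q^n : Σ (ℓ+1)^i x_i = α·S_n + r}`, `α = ⌊(q-1)/2⌋`,
`S_n = Σ_{i<n} (ℓ+1)^i`. -/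
noncomputable def gam (q ℓ : ℤ) (n : ℕ) (r : ℤ) : ℕ :=
  Set.ncard {x : Fin n → ℤ | inQ q x ∧
    ∑ i : Fin n, (ℓ + 1) ^ (i : ℕ) * x i
      = ((q - 1) / 2) * (∑ i ∈ Finset.range n, (ℓ + 1) ^ i) + r}

/-- Chebyshev-type bound on the second moment of a sum of centred integer variables. -/
theorem sum_sq_sum_le {α : Type*} [Fintype α] (f : α → ℤ) (hf : ∑ a, f a = 0) (c : ℤ)
    (hc : ∀ a, f a ^ 2 ≤ c) (N : ℕ) :
    ∑ y : Fin N → α, (∑ i, f (y i)) ^ 2 ≤ N * c * (Fintype.card α : ℤ) ^ N := by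
  induction N with
  | zero => simp
  | succ N ih =>
    rw [← (Fin.consEquiv fun _ : Fin (N + 1) => α).sum_comp, Fintype.sum_prod_type]
    have hstep : ∀ a : α, ∑ y : Fin N → α,
        (∑ i, f ((Fin.consEquiv fun _ : Fin (N + 1) => α) (a, y) i)) ^ 2
        = (Fintype.card α : ℤ) ^ N * f a ^ 2
          + f a * (2 * ∑ y : Fin N → α, ∑ i, f (y i))
          + ∑ y : Fin N → α, (∑ i, f (y i)) ^ 2 := by
      intro a
      have hy : ∀ y : Fin N → α,
          (∑ i, f ((Fin.consEquiv fun _ : Fin (N + 1) => α) (a, y) i)) ^ 2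
          = f a ^ 2 + (f a * 2) * (∑ i, f (y i)) + (∑ i, f (y i)) ^ 2 := by
        intro y
        simp only [Fin.consEquiv_apply, Fin.sum_univ_succ, Fin.cons_zero, Fin.cons_succ]
        ring
      simp only [hy, Finset.sum_add_distrib, ← Finset.mul_sum, Finset.sum_const,
        Finset.card_univ, Fintype.card_fun, Fintype.card_fin, nsmul_eq_mul, Nat.cast_pow]
      ring
    simp only [hstep, Finset.sum_add_distrib, ← Finset.mul_sum, ← Finset.sum_mul, hf,
      Finset.sum_const, Finset.card_univ, nsmul_eq_mul, zero_mul, add_zero]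
    have h1 : ∑ a, f a ^ 2 ≤ Fintype.card α * c := by
      simpa using Finset.sum_le_sum fun a (_ : a ∈ Finset.univ) => hc a
    have h2 := mul_le_mul_of_nonneg_left h1
      (by positivity : (0 : ℤ) ≤ (Fintype.card α : ℤ) ^ N)
    have h3 := mul_le_mul_of_nonneg_left ih (by positivity : (0 : ℤ) ≤ (Fintype.card α : ℤ))
    push_cast
    rw [pow_succ]
    linarith

theorem sum_fin_two_mul_sub (B : ℕ) : ∑ j : Fin B, (2 * ((j : ℕ) : ℤ) - (B - 1)) = 0 := by
  rw [Fin.sum_univ_eq_sum_range (fun j => 2 * (j : ℤ) - ((B : ℤ) - 1))]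
  have h : ∀ (k : ℕ) (c : ℤ), ∑ j ∈ Finset.range k, (2 * (j : ℤ) - c) = k * (k - 1) - k * c := by
    intro k c
    induction k with
    | zero => simp
    | succ k ih => rw [Finset.sum_range_succ, ih]; push_cast; ring
  rw [h]
  ring

/-- At least half of the words over `{0,…,B-1}` have letter sum in a window of radius `P / 2`
around the mean. -/
theorem pow_le_two_mul_card_window (B N : ℕ) (P : ℤ) (hP : 2 * N * (B : ℤ) ^ 2 ≤ P ^ 2)
    (hP0 : 0 < P) :
    B ^ N ≤ 2 * (Finset.univ.filter fun y : Fin N → Fin B =>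
      (∑ i, (2 * ((y i : ℕ) : ℤ) - (B - 1))) ^ 2 < P ^ 2).card := by
  have hmom := sum_sq_sum_le (fun j : Fin B => 2 * ((j : ℕ) : ℤ) - (B - 1))
    (sum_fin_two_mul_sub B) ((B : ℤ) ^ 2) (by
      intro j
      have := j.2
      apply sq_le_sq'
      · omega
      · omega) N
  simp only [Fintype.card_fin] at hmom
  set D : (Fin N → Fin B) → ℤ := fun y => ∑ i, (2 * ((y i : ℕ) : ℤ) - (B - 1)) with hD
  have hsplit := Finset.card_filter_add_card_filter_not (s := (Finset.univ : Finset (Fin N → Fin B)))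
    (fun y => D y ^ 2 < P ^ 2)
  simp only [Finset.card_univ, Fintype.card_fun, Fintype.card_fin] at hsplit
  have hbad : ((Finset.univ.filter fun y => ¬ D y ^ 2 < P ^ 2).card : ℤ) * P ^ 2
      ≤ ∑ y, D y ^ 2 := by
    calc _ = ∑ y ∈ Finset.univ.filter (fun y => ¬ D y ^ 2 < P ^ 2), P ^ 2 := by simp
      _ ≤ ∑ y ∈ Finset.univ.filter (fun y => ¬ D y ^ 2 < P ^ 2), D y ^ 2 :=
        Finset.sum_le_sum fun y hy => not_lt.1 (Finset.mem_filter.1 hy).2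
      _ ≤ _ := Finset.sum_le_sum_of_subset_of_nonneg (Finset.filter_subset _ _)
        fun y _ _ => sq_nonneg _
  have hpow : (0 : ℤ) ≤ (B : ℤ) ^ N := by positivity
  have hhalf : 2 * ((Finset.univ.filter fun y => ¬ D y ^ 2 < P ^ 2).card : ℤ) ≤ (B : ℤ) ^ N := by
    have hPP : 0 < P ^ 2 := by positivity
    refine le_of_mul_le_mul_right ?_ hPP
    have := mul_le_mul_of_nonneg_right hP hpow
    nlinarith
  have : 2 * (Finset.univ.filter fun y => ¬ D y ^ 2 < P ^ 2).card ≤ B ^ N := by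
    exact_mod_cast hhalf
  change B ^ N ≤ 2 * (Finset.univ.filter fun y => D y ^ 2 < P ^ 2).card
  omega

/-- Existence of base-`q` expansions with `m` digits. -/
theorem exists_digits (q : ℤ) (hq : 0 < q) (m : ℕ) :
    ∀ t : ℤ, 0 ≤ t → t < q ^ m →
      ∃ u : Fin m → ℤ, inQ q u ∧ ∑ i : Fin m, q ^ (i : ℕ) * u i = t := by
  induction m with
  | zero =>
    intro t h0 h1
    rw [pow_zero] at h1
    exact ⟨fun _ => 0, fun i => i.elim0, by simp; omega⟩
  | succ m ih =>
    intro t h0 h1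
    obtain ⟨u, hu, hsum⟩ := ih (t / q) (Int.ediv_nonneg h0 hq.le)
      (Int.ediv_lt_of_lt_mul hq (by rwa [pow_succ] at h1))
    refine ⟨Fin.cons (t % q) u, fun i => ?_, ?_⟩
    · refine Fin.cases ?_ (fun i => ?_) i
      · have := Int.emod_nonneg t hq.ne'
        have := Int.emod_lt_of_pos t hq
        simp only [Fin.cons_zero]
        omega
      · simpa using hu i
    · simp only [Fin.sum_univ_succ, Fin.val_zero, pow_zero, Fin.cons_zero, one_mul, Fin.val_succ,
        Fin.cons_succ, pow_succ', mul_assoc, ← Finset.mul_sum, hsum]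
      exact Int.emod_add_mul_ediv t q

theorem card_le_Au {q : ℤ} {n : ℕ} {ℓ : ℤ} (C : Finset (Fin n → ℤ)) (hC : ∀ x ∈ C, inQ q x)
    (hd : ∀ x ∈ C, ∀ y ∈ C, x ≠ y → 2 * ℓ + 1 ≤ du x y) : C.card ≤ Au q n ℓ := by
  refine le_csSup ⟨(Fintype.piFinset fun _ : Fin n => Finset.Icc 0 (q - 1)).card, ?_⟩
    ⟨C, hC, hd, rfl⟩
  rintro k ⟨C', hC', -, rfl⟩
  refine Finset.card_le_card fun x hx => ?_
  exact Fintype.mem_piFinset.2 fun i => Finset.mem_Icc.2 (hC' x hx i)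

theorem natAbs_le_dmax {n : ℕ} (x y : Fin n → ℤ) (i : Fin n) :
    ((x i - y i).natAbs : ℤ) ≤ dmax x y := by
  unfold dmax
  exact_mod_cast Finset.le_sup (f := fun i => (x i - y i).natAbs) (Finset.mem_univ i)

/-- Words on which a positive linear form agrees are equal as soon as they are comparable. -/
theorem eq_of_le_of_sum_eq {n : ℕ} {w x y : Fin n → ℤ} (hw : ∀ i, 0 < w i)
    (h : ∀ i, x i ≤ y i) (hs : ∑ i, w i * x i = ∑ i, w i * y i) : x = y := by
  have := (Finset.sum_eq_sum_iff_of_le fun i _ => mul_le_mul_of_nonneg_left (h i) (hw i).le).1 hs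
  exact funext fun i => mul_left_cancel₀ (hw i).ne' (this i (Finset.mem_univ i))

/-- Words with the same value of a positive linear form and differing by more than `ℓ` somewhere
are at distance at least `2ℓ+1`. -/
theorem two_mul_add_one_le_du {n : ℕ} {ℓ : ℤ} {w x y : Fin n → ℤ} (hw : ∀ i, 0 < w i)
    (hs : ∑ i, w i * x i = ∑ i, w i * y i) (hne : x ≠ y) (hd : ℓ + 1 ≤ dmax x y) :
    2 * ℓ + 1 ≤ du x y := by
  unfold du
  rw [if_neg]
  · omega
  · rintro (h | h)
    · exact hne (eq_of_le_of_sum_eq hw h hs.symm).symm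
    · exact hne (eq_of_le_of_sum_eq hw h hs)

/-- Words over the multiples of `ℓ+1`, with letter sum in a window of length `q^m`, are completed
to a UEC code by `m` coordinates recording the letter sum in base `q`. -/
theorem card_window_le_Au {q ℓ : ℤ} (hq : 2 ≤ q) (hℓ : 0 ≤ ℓ) (B m N : ℕ)
    (hB : ((B : ℤ) - 1) * (ℓ + 1) ≤ q - 1) :
    (Finset.univ.filter fun y : Fin N → Fin B =>
      (∑ i, (2 * ((y i : ℕ) : ℤ) - (B - 1))) ^ 2 < (q ^ m) ^ 2).card ≤ Au q (m + N) ℓ := by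
  have hPpos : 0 < q ^ m := by positivity
  set P := q ^ m with hP
  set M : ℤ := N * (B - 1) with hM
  set a : ℤ := (M + P - 1) / 2 with ha
  have hdig : ∀ y : Fin N → Fin B, ∃ u : Fin m → ℤ,
      (∑ i, (2 * ((y i : ℕ) : ℤ) - (B - 1))) ^ 2 < P ^ 2 →
      inQ q u ∧ ∑ i : Fin m, q ^ (i : ℕ) * u i = a - ∑ i, ((y i : ℕ) : ℤ) := by
    intro y
    by_cases hy : (∑ i, (2 * ((y i : ℕ) : ℤ) - (B - 1))) ^ 2 < P ^ 2
    · obtain ⟨h1, h2⟩ := abs_lt.1 (abs_lt_of_sq_lt_sq hy hPpos.le)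
      rw [Finset.sum_sub_distrib, ← Finset.mul_sum, Finset.sum_const, Finset.card_univ,
        Fintype.card_fin, nsmul_eq_mul, ← hM] at h1 h2
      obtain ⟨u, hu⟩ := exists_digits q (by omega) m (a - ∑ i, ((y i : ℕ) : ℤ))
        (by omega) (by omega)
      exact ⟨u, fun _ => hu⟩
    · exact ⟨0, fun h => absurd h hy⟩
  choose u hu using hdig
  set g : (Fin N → Fin B) → (Fin (m + N) → ℤ) :=
    fun y => Fin.append (u y) fun i => (ℓ + 1) * ((y i : ℕ) : ℤ) with hg
  have hginj : Function.Injective g := by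
    intro y z h
    ext i
    have := congrFun h (Fin.natAdd m i)
    simp only [hg, Fin.append_right] at this
    exact_mod_cast mul_left_cancel₀ (by omega : ℓ + 1 ≠ 0) this
  rw [← Finset.card_image_of_injective _ hginj]
  refine card_le_Au _ ?_ ?_
  · intro x hx
    obtain ⟨y, hy, rfl⟩ := Finset.mem_image.1 hx
    have hy' := hu y (Finset.mem_filter.1 hy).2
    intro i
    refine Fin.addCases (fun i => ?_) (fun i => ?_) i
    · simpa [hg] using hy'.1 i
    · simp only [hg, Fin.append_right]
      have hlt : ((y i : ℕ) : ℤ) ≤ B - 1 := by have := (y i).2; omega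
      refine ⟨by positivity, ?_⟩
      nlinarith
  · intro x hx z hz hne
    obtain ⟨y, hy, rfl⟩ := Finset.mem_image.1 hx
    obtain ⟨y', hy', rfl⟩ := Finset.mem_image.1 hz
    set w : Fin (m + N) → ℤ :=
      Fin.append (fun i : Fin m => (ℓ + 1) * q ^ (i : ℕ)) (fun _ : Fin N => 1) with hw
    have hwsum : ∀ v, (∑ i, (2 * ((v i : ℕ) : ℤ) - (B - 1))) ^ 2 < P ^ 2 →
        ∑ i, w i * g v i = (ℓ + 1) * a := by
      intro v hv
      rw [Fin.sum_univ_add]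
      simp only [hw, hg, Fin.append_left, Fin.append_right, mul_assoc, ← Finset.mul_sum, one_mul,
        (hu v hv).2]
      ring
    refine two_mul_add_one_le_du (w := w) ?_ ?_ hne ?_
    · intro i
      refine Fin.addCases (fun i => ?_) (fun i => ?_) i
      · simp only [hw, Fin.append_left]
        positivity
      · simp [hw]
    · rw [hwsum y (Finset.mem_filter.1 hy).2, hwsum y' (Finset.mem_filter.1 hy').2]
    · have hyy : y ≠ y' := fun h => hne (by rw [h])
      obtain ⟨i, hi⟩ := Function.ne_iff.1 hyy
      refine le_trans ?_ (natAbs_le_dmax _ _ (Fin.natAdd m i))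
      simp only [hg, Fin.append_right, ← mul_sub, Int.natCast_natAbs, abs_mul]
      have h1 : (1 : ℤ) ≤ |((y i : ℕ) : ℤ) - ((y' i : ℕ) : ℤ)| := by
        have : (y i : ℕ) ≠ (y' i : ℕ) := fun h => hi (Fin.ext h)
        exact Int.one_le_abs (by omega)
      rw [abs_of_nonneg (by omega : 0 ≤ ℓ + 1)]
      nlinarith

theorem one_le_Au {q : ℤ} (hq : 2 ≤ q) (n : ℕ) (ℓ : ℤ) : 1 ≤ Au q n ℓ := by
  simpa using card_le_Au (q := q) (ℓ := ℓ) ({0} : Finset (Fin n → ℤ))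
    (by intro x hx i; simp only [Finset.mem_singleton] at hx; subst hx; simp; omega)
    (by simp +contextual)

theorem pow_le_two_mul_pow_mul_Au {q ℓ : ℤ} (hq : 2 ≤ q) (hℓ : 0 ≤ ℓ) (B m n : ℕ) (hB0 : 1 ≤ B)
    (hB : ((B : ℤ) - 1) * (ℓ + 1) ≤ q - 1) (hm : 2 * n * (B : ℤ) ^ 2 ≤ (q ^ m) ^ 2) :
    B ^ n ≤ 2 * B ^ m * Au q n ℓ := by
  rcases le_total m n with h | h
  · obtain ⟨N, rfl⟩ := Nat.exists_eq_add_of_le h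
    have h1 := pow_le_two_mul_card_window B N (q ^ m)
      (le_trans (by push_cast; gcongr; omega) hm) (by positivity)
    have h2 := card_window_le_Au hq hℓ B m N hB
    calc B ^ (m + N) = B ^ m * B ^ N := pow_add _ _ _
      _ ≤ B ^ m * (2 * Au q (m + N) ℓ) := by gcongr; omega
      _ = _ := by ring
  · calc B ^ n ≤ B ^ m := Nat.pow_le_pow_right hB0 h
      _ ≤ B ^ m * (2 * Au q n ℓ) := Nat.le_mul_of_pos_right _ (by have := one_le_Au hq n ℓ; omega)
      _ = _ := by ring

/-- with `b = ⌈q/(ℓ+1)⌉`, there is `K > 0` with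
`A_u(n,ℓ)_q ≥ K · b^n · n^{-(1/2)·log_q b}` for all `n ≥ 1`. -/
theorem stmt9 (q : ℤ) (hq : 2 ≤ q) (ℓ : ℤ) (hℓ0 : 0 ≤ ℓ) (hℓq : ℓ ≤ q - 1) :
    ∃ K : ℝ, 0 < K ∧ ∀ n : ℕ, 1 ≤ n →
      K * ((⌈(q : ℚ) / ((ℓ : ℚ) + 1)⌉ : ℤ) : ℝ) ^ n *
          (n : ℝ) ^ (-(1 / 2 : ℝ) *
            Real.logb q ((⌈(q : ℚ) / ((ℓ : ℚ) + 1)⌉ : ℤ) : ℝ))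
        ≤ (Au q n ℓ : ℝ) := by
  have hL : (0 : ℚ) < (ℓ : ℚ) + 1 := by exact_mod_cast (by omega : 0 < ℓ + 1)
  have hq0 : (0 : ℚ) < q := by exact_mod_cast (by omega : 0 < q)
  have hceil : 0 < ⌈(q : ℚ) / ((ℓ : ℚ) + 1)⌉ := Int.ceil_pos.2 (div_pos hq0 hL)
  have hlt : ((⌈(q : ℚ) / ((ℓ : ℚ) + 1)⌉ : ℤ) - 1) * (ℓ + 1) ≤ q - 1 := by
    have h1 := Int.ceil_lt_add_one ((q : ℚ) / ((ℓ : ℚ) + 1))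
    have h2 : ((⌈(q : ℚ) / ((ℓ : ℚ) + 1)⌉ : ℤ) - 1 : ℚ) * ((ℓ : ℚ) + 1) < q := by
      rw [← lt_div_iff₀ hL]
      linarith
    have h3 : ((⌈(q : ℚ) / ((ℓ : ℚ) + 1)⌉ : ℤ) - 1) * (ℓ + 1) < q := by exact_mod_cast h2
    omega
  obtain ⟨B, hB⟩ := Int.eq_ofNat_of_zero_le hceil.le
  rw [hB] at hceil hlt ⊢
  have hB1 : 1 ≤ B := by omega
  have hBr : (1 : ℝ) ≤ B := by exact_mod_cast hB1
  have hBpos : (0 : ℝ) < B := by linarith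
  have hqr : (2 : ℝ) ≤ q := by exact_mod_cast hq
  have hqpos : (0 : ℝ) < q := by linarith
  rw [Int.cast_natCast]
  set θ := Real.logb q B with hθ
  have hθ0 : 0 ≤ θ := Real.logb_nonneg (by linarith) hBr
  have hqθ : (q : ℝ) ^ θ = B := Real.rpow_logb hqpos (by linarith) hBpos
  set c : ℝ := q ^ 2 * (2 * B ^ 2) with hc
  have hcpos : 0 < c := by positivity
  refine ⟨(2 * c ^ (θ / 2))⁻¹, by positivity, fun n hn => ?_⟩
  have hnr : (0 : ℝ) < n := by exact_mod_cast hn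
  have hex : ∃ m : ℕ, 2 * (n : ℤ) * (B : ℤ) ^ 2 ≤ (q ^ m) ^ 2 := by
    obtain ⟨m, hm⟩ := pow_unbounded_of_one_lt (2 * (n : ℤ) * (B : ℤ) ^ 2) (by omega : 1 < q)
    refine ⟨m, hm.le.trans (le_self_pow₀ (one_le_pow₀ (by omega)) two_ne_zero)⟩
  classical
  obtain ⟨m, hm, hmin⟩ : ∃ m : ℕ, 2 * (n : ℤ) * (B : ℤ) ^ 2 ≤ (q ^ m) ^ 2 ∧
      ((q : ℝ) ^ m) ^ 2 ≤ c * n := by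
    refine ⟨Nat.find hex, Nat.find_spec hex, ?_⟩
    rcases h : Nat.find hex with _ | k
    · have h1 : (1 : ℝ) ≤ n := by exact_mod_cast hn
      have h2 : 1 ≤ (q : ℝ) ^ 2 := one_le_pow₀ (by linarith)
      have h3 : (1 : ℝ) ≤ B ^ 2 := one_le_pow₀ hBr
      have h4 : 1 ≤ c := by rw [hc]; nlinarith
      rw [pow_zero, one_pow]
      nlinarith
    · have h1 := not_le.1 (Nat.find_min hex (m := k) (by omega))
      have h2 : ((q : ℝ) ^ k) ^ 2 < 2 * n * B ^ 2 := by exact_mod_cast h1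
      calc ((q : ℝ) ^ (k + 1)) ^ 2 = (q : ℝ) ^ 2 * ((q : ℝ) ^ k) ^ 2 := by ring
        _ ≤ (q : ℝ) ^ 2 * (2 * n * B ^ 2) := by gcongr
        _ = c * n := by rw [hc]; ring
  have hcount : (B : ℝ) ^ n ≤ 2 * (B : ℝ) ^ m * Au q n ℓ := by
    exact_mod_cast pow_le_two_mul_pow_mul_Au hq hℓ0 B m n hB1 hlt hm
  have hBm : (B : ℝ) ^ m ≤ c ^ (θ / 2) * (n : ℝ) ^ (θ / 2) := by
    rw [← Real.mul_rpow hcpos.le hnr.le]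
    calc (B : ℝ) ^ m = (((q : ℝ) ^ m) ^ 2) ^ (θ / 2) := by
          rw [← hqθ, ← Real.rpow_natCast, ← Real.rpow_natCast, ← Real.rpow_natCast,
            ← Real.rpow_mul hqpos.le, ← Real.rpow_mul hqpos.le, ← Real.rpow_mul hqpos.le]
          congr 1
          push_cast
          ring
      _ ≤ _ := Real.rpow_le_rpow (by positivity) hmin (by positivity)
  have hexp : -(1 / 2 : ℝ) * θ = -(θ / 2) := by ring
  rw [hexp, Real.rpow_neg hnr.le, mul_assoc, inv_mul_le_iff₀ (by positivity),
    ← div_eq_mul_inv, div_le_iff₀ (by positivity)]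
  calc (B : ℝ) ^ n ≤ 2 * (B : ℝ) ^ m * Au q n ℓ := hcount
    _ ≤ 2 * (c ^ (θ / 2) * (n : ℝ) ^ (θ / 2)) * Au q n ℓ := by gcongr
    _ = _ := by ring
end

section
/- Let ℓ ≥ 1, b ≥ 2 and d be integers with 1 ≤ b − 1 < d ≤ ℓ, and set q = (b−1)(ℓ+1) + d. Then for every integer n ≥ 1, LA_u(n,ℓ)_q = b^{n−1} = ⌈q/(ℓ+1)⌉^{n−1}. -/
open Finset Filter

lemma dmax_le_iff {n : ℕ} {x y : Fin n → ℤ} {ℓ : ℤ} (hℓ : 0 ≤ ℓ) :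
    dmax x y ≤ ℓ ↔ ∀ i, |x i - y i| ≤ ℓ := by
  lift ℓ to ℕ using hℓ
  simp only [dmax, Nat.cast_le, Finset.sup_le_iff, Finset.mem_univ, true_imp_iff,
    Int.abs_eq_natAbs]

lemma lt_dmax_of_le_du {n : ℕ} {x y : Fin n → ℤ} {ℓ : ℤ} (hℓ : 0 ≤ ℓ)
    (h : 2 * ℓ + 1 ≤ du x y) : ℓ < dmax x y := by
  unfold du at h
  split_ifs at h <;> omega

/-- A nonzero integer vector is a multiple of a vector admitting a Bézout relation. -/
lemma exists_primitive {ι : Type*} [Fintype ι] (coef : ι → ℤ) (h : ∃ i, coef i ≠ 0) :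
    ∃ (g : ℤ) (e w : ι → ℤ), g ≠ 0 ∧ (∀ i, coef i = g * e i) ∧ ∑ i, e i * w i = 1 := by
  obtain ⟨g, hg⟩ := (IsPrincipalIdealRing.principal (Ideal.span (Set.range coef))).principal
  have hdvd : ∀ i, g ∣ coef i := fun i => by
    rw [← Ideal.mem_span_singleton, ← Ideal.submodule_span_eq, ← hg]
    exact Ideal.subset_span ⟨i, rfl⟩
  choose e he using hdvd
  have hg0 : g ≠ 0 := by
    rintro rfl
    obtain ⟨i, hi⟩ := h
    exact hi (by simp [he i])
  have hmem : g ∈ Ideal.span (Set.range coef) := by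
    rw [hg]
    exact Submodule.mem_span_singleton_self g
  obtain ⟨w, hw⟩ := Ideal.mem_span_range_iff_exists_fun.mp hmem
  refine ⟨g, e, w, hg0, he, mul_left_cancel₀ hg0 ?_⟩
  rw [Finset.mul_sum, mul_one]
  refine Eq.trans (Finset.sum_congr rfl fun i _ => ?_) hw
  rw [he i]
  ring

/-- A point of the solution set one `b`-th of the way between two congruent codewords shows that
a VT-type code with minimum distance above `ℓ` injects into `(ℤ/b)^n` when `q ≤ b(ℓ+1)`. -/
lemma eq_of_forall_dvd_sub {n : ℕ} {q ℓ b : ℤ} (hℓ : 0 ≤ ℓ) (hb : 1 ≤ b)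
    (hq : q ≤ b * (ℓ + 1)) {C : Finset (Fin n → ℤ)} (hC : IsVT q C)
    (hdist : ∀ x ∈ C, ∀ y ∈ C, x ≠ y → ℓ < dmax x y)
    {x y : Fin n → ℤ} (hx : x ∈ C) (hy : y ∈ C) (h : ∀ i, b ∣ y i - x i) : x = y := by
  obtain ⟨coef, a, hmem⟩ := hC
  choose z hz using h
  obtain ⟨hxQ, hxa⟩ := (hmem x).1 hx
  obtain ⟨hyQ, hya⟩ := (hmem y).1 hy
  have hz0 : ∑ i, coef i * z i = 0 := by
    have : b * ∑ i, coef i * z i = ∑ i, coef i * y i - ∑ i, coef i * x i := by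
      rw [Finset.mul_sum, ← Finset.sum_sub_distrib]
      refine Finset.sum_congr rfl fun i _ => ?_
      rw [← mul_sub, hz i]
      ring
    rw [hxa, hya, sub_self] at this
    exact (mul_eq_zero.1 this).resolve_left (by omega)
  have hzabs : ∀ i, |z i| ≤ ℓ := fun i => by
    have h1 := hxQ i
    have h2 := hyQ i
    have h3 := hz i
    rw [abs_le]
    constructor <;> nlinarith
  have hxz : x + z ∈ C := by
    rw [hmem]
    refine ⟨fun i => ?_, ?_⟩
    · have h1 := hxQ i
      have h2 := hyQ i
      have h3 := hz i
      simp only [Pi.add_apply]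
      rcases le_total 0 (z i) with h0 | h0
      · constructor <;> nlinarith
      · constructor <;> nlinarith
    · simp only [Pi.add_apply, mul_add, Finset.sum_add_distrib, hxa, hz0, add_zero]
  have hxeq : x = x + z := by
    by_contra hne
    refine absurd ((dmax_le_iff hℓ).2 fun i => ?_) (not_le.2 (hdist _ hx _ hxz hne))
    simpa using hzabs i
  funext i
  have h1 := congrFun hxeq i
  have h2 := hz i
  simp only [Pi.add_apply] at h1
  rw [show z i = 0 by omega] at h2
  omega

lemma IsVT.exists_coef_ne_zero {n : ℕ} {q ℓ : ℤ} (hn : 1 ≤ n) (hℓ : 1 ≤ ℓ) (hq : 2 ≤ q)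
    {C : Finset (Fin n → ℤ)} (hdist : ∀ x ∈ C, ∀ y ∈ C, x ≠ y → ℓ < dmax x y)
    (hne : C.Nonempty) {coef : Fin n → ℤ} {a : ℤ}
    (hmem : ∀ x : Fin n → ℤ, x ∈ C ↔ (inQ q x ∧ ∑ i, coef i * x i = a)) :
    ∃ i, coef i ≠ 0 := by
  by_contra! h
  obtain ⟨x, hx⟩ := hne
  have ha : a = 0 := by
    rw [← ((hmem x).1 hx).2]
    simp [h]
  have h0 : (fun _ => 0 : Fin n → ℤ) ∈ C :=
    (hmem _).2 ⟨fun _ => by constructor <;> dsimp only <;> omega, by simp [ha]⟩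
  have h1 : (fun _ => 1 : Fin n → ℤ) ∈ C :=
    (hmem _).2 ⟨fun _ => by constructor <;> dsimp only <;> omega, by simp [ha, h]⟩
  have hne : (fun _ => 0 : Fin n → ℤ) ≠ fun _ => 1 := fun h' => by
    simpa using congrFun h' ⟨0, hn⟩
  refine absurd ((dmax_le_iff (by omega)).2 fun i => ?_) (not_le.2 (hdist _ h0 _ h1 hne))
  simpa using hℓ

/-- Size bound for VT-type codes with minimum distance above `ℓ`. -/
lemma IsVT.card_le {m b : ℕ} {q ℓ : ℤ} (hℓ : 1 ≤ ℓ) (hb : 1 ≤ b) (hq2 : 2 ≤ q)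
    (hq : q ≤ b * (ℓ + 1)) {C : Finset (Fin (m + 1) → ℤ)} (hC : IsVT q C)
    (hdist : ∀ x ∈ C, ∀ y ∈ C, x ≠ y → ℓ < dmax x y) : C.card ≤ b ^ m := by
  rcases C.eq_empty_or_nonempty with rfl | hne
  · simp
  obtain ⟨coef, a, hmem⟩ := id hC
  obtain ⟨g, e, w, hg, he, hw⟩ := exists_primitive coef
    (IsVT.exists_coef_ne_zero (by omega) hℓ hq2 hdist hne hmem)
  have hconst : ∀ x ∈ C, ∀ y ∈ C, ∑ i, e i * x i = ∑ i, e i * y i := fun x hx y hy => by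
    have key : ∀ z ∈ C, g * ∑ i, e i * z i = a := fun z hz => by
      rw [← ((hmem z).1 hz).2, Finset.mul_sum]
      exact Finset.sum_congr rfl fun i _ => by rw [he i, mul_assoc]
    exact mul_left_cancel₀ hg ((key x hx).trans (key y hy).symm)
  have : NeZero b := ⟨by omega⟩
  let F : C × ZMod b → (Fin (m + 1) → ZMod b) := fun p i =>
    (p.1.1 i : ZMod b) + p.2 * (w i : ZMod b)
  have hsum : ∀ p, ∑ i, (e i : ZMod b) * F p i = ((∑ i, e i * p.1.1 i : ℤ) : ZMod b) + p.2 := by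
    intro p
    have hw' : ∑ i, (e i : ZMod b) * (w i : ZMod b) = 1 := by
      exact_mod_cast congrArg (Int.cast : ℤ → ZMod b) hw
    calc ∑ i, (e i : ZMod b) * F p i
        = ∑ i, ((e i : ZMod b) * (p.1.1 i : ZMod b) + p.2 * ((e i : ZMod b) * (w i : ZMod b))) :=
          Finset.sum_congr rfl fun i _ => by simp only [F]; ring
      _ = _ := by rw [Finset.sum_add_distrib, ← Finset.mul_sum, hw']; push_cast; ring
  have hF : Function.Injective F := by
    rintro ⟨⟨x, hx⟩, s⟩ ⟨⟨y, hy⟩, t⟩ h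
    have hst : s = t := by
      have h1 := hsum (⟨x, hx⟩, s)
      rw [h, hsum (⟨y, hy⟩, t)] at h1
      simpa [hconst x hx y hy] using h1.symm
    subst hst
    have hxy : x = y := by
      refine eq_of_forall_dvd_sub (b := b) (by omega) (by omega) hq hC hdist hx hy fun i => ?_
      have h1 : (x i : ZMod b) = (y i : ZMod b) := by simpa [F] using congrFun h i
      exact (ZMod.intCast_eq_intCast_iff_dvd_sub _ _ _).1 h1
    subst hxy
    rfl
  have hcard := Fintype.card_le_of_injective F hF
  simp only [Fintype.card_prod, Fintype.card_coe, ZMod.card, Fintype.card_fun, Fintype.card_fin,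
    pow_succ] at hcard
  exact Nat.le_of_mul_le_mul_right hcard (by omega)

/-- The solution set in `Q^n` of `Σ (ℓ+1)^i x_i = a`. -/
noncomputable def powerCode (q ℓ : ℤ) (n : ℕ) (a : ℤ) : Finset (Fin n → ℤ) :=
  {x ∈ Fintype.piFinset fun _ => Finset.Icc 0 (q - 1) | ∑ i : Fin n, (ℓ + 1) ^ (i : ℕ) * x i = a}

lemma mem_powerCode {q ℓ : ℤ} {n : ℕ} {a : ℤ} {x : Fin n → ℤ} :
    x ∈ powerCode q ℓ n a ↔ inQ q x ∧ ∑ i : Fin n, (ℓ + 1) ^ (i : ℕ) * x i = a := by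
  simp [powerCode, inQ]

lemma isVT_powerCode (q ℓ : ℤ) (n : ℕ) (a : ℤ) : IsVT q (powerCode q ℓ n a) :=
  ⟨fun i => (ℓ + 1) ^ (i : ℕ), a, fun _ => mem_powerCode⟩

lemma eq_zero_of_sum_pow_mul_eq_zero {ℓ : ℤ} (hℓ : 0 ≤ ℓ) {n : ℕ} {y : Fin n → ℤ}
    (hy : ∀ i, |y i| ≤ ℓ) (h : ∑ i : Fin n, (ℓ + 1) ^ (i : ℕ) * y i = 0) : y = 0 := by
  induction n with
  | zero => exact Subsingleton.elim _ _
  | succ n ih =>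
    have hs : y 0 + (ℓ + 1) * ∑ i : Fin n, (ℓ + 1) ^ (i : ℕ) * y i.succ = 0 := by
      rw [← h, Fin.sum_univ_succ, Finset.mul_sum]
      simp [pow_succ', mul_assoc]
    have h0 : y 0 = 0 :=
      Int.eq_zero_of_abs_lt_dvd ((Int.dvd_add_left (dvd_mul_right _ _)).1 (hs ▸ dvd_zero _))
        (lt_of_le_of_lt (hy 0) (by omega))
    rw [h0, zero_add] at hs
    have h1 := ih (fun i => hy i.succ) ((mul_eq_zero.1 hs).resolve_left (by omega))
    funext i
    refine Fin.cases h0 (fun j => ?_) i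
    exact congrFun h1 j

lemma eq_of_le_of_sum_pow_mul_eq {ℓ : ℤ} (hℓ : 0 ≤ ℓ) {n : ℕ} {x y : Fin n → ℤ}
    (hle : ∀ i, x i ≤ y i)
    (h : ∑ i : Fin n, (ℓ + 1) ^ (i : ℕ) * x i = ∑ i : Fin n, (ℓ + 1) ^ (i : ℕ) * y i) :
    x = y := by
  have hpos : ∀ i : Fin n, 0 < (ℓ + 1) ^ (i : ℕ) := fun i => by positivity
  have := (Finset.sum_eq_sum_iff_of_le
    fun i _ => mul_le_mul_of_nonneg_left (hle i) (hpos i).le).1 h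
  exact funext fun i => mul_left_cancel₀ (hpos i).ne' (this i (Finset.mem_univ i))

lemma powerCode_le_du {q ℓ : ℤ} (hℓ : 0 ≤ ℓ) {n : ℕ} {a : ℤ} {x y : Fin n → ℤ}
    (hx : x ∈ powerCode q ℓ n a) (hy : y ∈ powerCode q ℓ n a) (hne : x ≠ y) :
    2 * ℓ + 1 ≤ du x y := by
  obtain ⟨-, hx⟩ := mem_powerCode.1 hx
  obtain ⟨-, hy⟩ := mem_powerCode.1 hy
  have hinc : ¬ ((∀ i, y i ≤ x i) ∨ (∀ i, x i ≤ y i)) := by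
    rintro (h | h)
    · exact hne (eq_of_le_of_sum_pow_mul_eq hℓ h (hy.trans hx.symm)).symm
    · exact hne (eq_of_le_of_sum_pow_mul_eq hℓ h (hx.trans hy.symm))
  have hd : ℓ < dmax x y := by
    by_contra! h
    refine hne (sub_eq_zero.1 (eq_zero_of_sum_pow_mul_eq_zero hℓ
      (y := x - y) ((dmax_le_iff hℓ).1 h) ?_))
    simp only [Pi.sub_apply, mul_sub, Finset.sum_sub_distrib, hx, hy, sub_self]
  rw [du, if_neg hinc]
  omega

/-- The sequence `0, k 0, …, k (m-1), 0, 0, …` of carries. -/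
def carry {m b : ℕ} (k : Fin m → Fin b) : ℕ → ℤ
  | 0 => 0
  | j + 1 => if h : j < m then ((k ⟨j, h⟩ : ℕ) : ℤ) else 0

lemma carry_mem {m b : ℕ} (hb : 1 ≤ b) (k : Fin m → Fin b) (j : ℕ) :
    0 ≤ carry k j ∧ carry k j ≤ b - 1 := by
  cases j with
  | zero => simp only [carry]; omega
  | succ j =>
    simp only [carry]
    split_ifs with h
    · have := (k ⟨j, h⟩).2
      omega
    · omega

/-- The word with digits `b - 1 - carry k i + (ℓ+1) * carry k (i+1)`. -/
def carryWord {m b : ℕ} (ℓ : ℤ) (k : Fin m → Fin b) (i : Fin (m + 1)) : ℤ :=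
  (b - 1) - carry k i + (ℓ + 1) * carry k (i + 1)

lemma sum_carry {m b : ℕ} (ℓ : ℤ) (k : Fin m → Fin b) (n : ℕ) :
    ∑ i ∈ Finset.range n, (ℓ + 1) ^ i * ((b - 1) - carry k i + (ℓ + 1) * carry k (i + 1)) =
      (b - 1) * ∑ i ∈ Finset.range n, (ℓ + 1) ^ i + (ℓ + 1) ^ n * carry k n := by
  induction n with
  | zero => simp [carry]
  | succ n ih => rw [Finset.sum_range_succ, ih, Finset.sum_range_succ]; ring

lemma carryWord_mem {m b : ℕ} {q ℓ : ℤ} (hℓ : 0 ≤ ℓ) (hb : 1 ≤ b)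
    (hq : (b - 1) * (ℓ + 1) + b ≤ q) (k : Fin m → Fin b) :
    carryWord ℓ k ∈
      powerCode q ℓ (m + 1) ((b - 1) * ∑ i ∈ Finset.range (m + 1), (ℓ + 1) ^ i) := by
  refine mem_powerCode.2 ⟨fun i => ?_, ?_⟩
  · obtain ⟨h1, h2⟩ := carry_mem hb k i
    obtain ⟨h3, h4⟩ := carry_mem hb k (i + 1)
    have h5 : 0 ≤ (ℓ + 1) * carry k (i + 1) := mul_nonneg (by omega) h3
    have h6 : (ℓ + 1) * carry k (i + 1) ≤ (b - 1) * (ℓ + 1) := by nlinarith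
    simp only [carryWord]
    omega
  · have h := sum_carry ℓ k (m + 1)
    rw [show carry k (m + 1) = 0 by simp [carry], mul_zero, add_zero] at h
    rw [← h, Finset.sum_range]
    rfl

lemma carryWord_injective {m b : ℕ} {ℓ : ℤ} (hℓ : 0 ≤ ℓ) :
    Function.Injective (carryWord ℓ : (Fin m → Fin b) → Fin (m + 1) → ℤ) := by
  intro k k' h
  have hc : ∀ j ≤ m, carry k j = carry k' j := by
    intro j
    induction j with
    | zero => intro _; rfl
    | succ j ih =>
      intro hj
      have h1 := congrFun h ⟨j, by omega⟩
      simp only [carryWord, ih (by omega)] at h1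
      exact mul_left_cancel₀ (by omega : ℓ + 1 ≠ 0) (by linarith)
  funext i
  have h1 := hc (i + 1) (by omega)
  simp only [carry, i.2, dif_pos] at h1
  exact Fin.ext (by exact_mod_cast h1)

lemma LAu_eq {m b : ℕ} {q ℓ : ℤ} (hℓ : 1 ≤ ℓ) (hb : 1 ≤ b) (hq2 : 2 ≤ q)
    (hlow : (b - 1) * (ℓ + 1) + b ≤ q) (hup : q ≤ b * (ℓ + 1)) :
    LAu q (m + 1) ℓ = b ^ m := by
  have hbound : ∀ C : Finset (Fin (m + 1) → ℤ), IsVT q C →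
      (∀ x ∈ C, ∀ y ∈ C, x ≠ y → 2 * ℓ + 1 ≤ du x y) → C.card ≤ b ^ m := fun C hC h =>
    hC.card_le hℓ hb hq2 hup fun x hx y hy hne => lt_dmax_of_le_du (by omega) (h x hx y hy hne)
  refine IsGreatest.csSup_eq ⟨?_, ?_⟩
  · refine ⟨powerCode q ℓ (m + 1) ((b - 1) * ∑ i ∈ Finset.range (m + 1), (ℓ + 1) ^ i),
      isVT_powerCode .., fun x hx y hy => powerCode_le_du (by omega) hx hy, ?_⟩
    refine le_antisymm (hbound _ (isVT_powerCode ..)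
      fun x hx y hy => powerCode_le_du (by omega) hx hy) ?_
    have := Finset.card_le_card_of_injOn (s := (Finset.univ : Finset (Fin m → Fin b)))
      (carryWord ℓ) (fun k _ => carryWord_mem (by omega) hb hlow k)
      (carryWord_injective (by omega)).injOn
    simpa using this
  · rintro _ ⟨C, hC, h, rfl⟩
    exact hbound C hC h

/-- for `q = (b-1)(ℓ+1) + d` with `1 ≤ b-1 < d ≤ ℓ`,
`LA_u(n,ℓ)_q = b^{n-1} = ⌈q/(ℓ+1)⌉^{n-1}` for every `n ≥ 1`. -/
theorem stmt16 (ℓ b d : ℤ) (hℓ : 1 ≤ ℓ) (hb : 1 ≤ b - 1) (hbd : b - 1 < d)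
    (hd : d ≤ ℓ) (q : ℤ) (hq : q = (b - 1) * (ℓ + 1) + d) :
    ∀ n : ℕ, 1 ≤ n →
      (LAu q n ℓ : ℤ) = b ^ (n - 1) ∧
      b ^ (n - 1) = ⌈(q : ℚ) / ((ℓ : ℚ) + 1)⌉ ^ (n - 1) := by
  intro n hn
  obtain ⟨m, rfl⟩ := Nat.exists_eq_add_of_le' hn
  lift b to ℕ using by omega
  have hlow : ((b : ℤ) - 1) * (ℓ + 1) + b ≤ q := by omega
  have hup : q ≤ b * (ℓ + 1) := by nlinarith
  have hceil : ⌈(q : ℚ) / ((ℓ : ℚ) + 1)⌉ = (b : ℤ) := by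
    have hpos : (0 : ℚ) < (ℓ : ℚ) + 1 := by exact_mod_cast (by omega : 0 < ℓ + 1)
    rw [Int.ceil_eq_iff, lt_div_iff₀ hpos, div_le_iff₀ hpos]
    constructor
    · exact_mod_cast (by omega : ((b : ℤ) - 1) * (ℓ + 1) < q)
    · exact_mod_cast hup
  refine ⟨?_, by rw [hceil]⟩
  rw [LAu_eq hℓ (by omega) (by nlinarith) hlow hup, Nat.add_sub_cancel, Nat.cast_pow]
end
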